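/- Let S be a semiring, n a natural number, and L an n × n matrix over S that is strictly lower triangular (L_{ij} = 0 whenever i ≤ j). Then the matrix L* := I + L + L² + … + L^{n−1} satisfies the closure identity L* = I + L · L* = I + L* · L; that is, the finite geometric series gives a closure of a strictly triangular matrix. -/

import Mathlib

/-- The `k`-th power of a strictly lower triangular matrix vanishes above the `k`-th
subdiagonal. -/
theorem Matrix.pow_apply_eq_zero_of_strictly_lower {S : Type*} [Semiring S] {n : ℕ}
    {L : Matrix (Fin n) (Fin n) S} (hL : ∀ i j : Fin n, i ≤ j → L i j = 0) (k : ℕ)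
    (i j : Fin n) (hij : (i : ℕ) < j + k) : (L ^ k) i j = 0 := by
  induction k generalizing i j with
  | zero =>
    rw [pow_zero, Matrix.one_apply_ne]
    rintro rfl
    omega
  | succ k ih =>
    rw [pow_succ, Matrix.mul_apply]
    refine Finset.sum_eq_zero fun m _ => ?_
    by_cases hm : m ≤ j
    · rw [hL m j hm, mul_zero]
    · rw [ih i m (by rw [not_le, Fin.lt_def] at hm; omega), zero_mul]

/-- A strictly lower triangular `n × n` matrix is nilpotent of index at most `n`. -/
theorem Matrix.pow_eq_zero_of_strictly_lower {S : Type*} [Semiring S] {n : ℕ}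
    {L : Matrix (Fin n) (Fin n) S} (hL : ∀ i j : Fin n, i ≤ j → L i j = 0) :
    L ^ n = 0 := by
  ext i j
  exact Matrix.pow_apply_eq_zero_of_strictly_lower hL n i j (by omega)

/-- If `L` is a strictly lower triangular `n × n` matrix over a semiring, then
`L* := I + L + L² + … + L^{n-1}` satisfies the closure identity
`L* = I + L * L* = I + L* * L`. -/
theorem strictly_triangular_closure {S : Type*} [Semiring S] {n : ℕ}
    (L : Matrix (Fin n) (Fin n) S) (hL : ∀ i j : Fin n, i ≤ j → L i j = 0) :
    (∑ i ∈ Finset.range n, L ^ i) = 1 + L * (∑ i ∈ Finset.range n, L ^ i) ∧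
    (∑ i ∈ Finset.range n, L ^ i) = 1 + (∑ i ∈ Finset.range n, L ^ i) * L := by
  have h : ∑ i ∈ Finset.range n, L ^ i = ∑ i ∈ Finset.range n, L ^ (i + 1) + 1 := by
    rw [← pow_zero L, ← Finset.sum_range_succ' (fun i => L ^ i), Finset.sum_range_succ,
      Matrix.pow_eq_zero_of_strictly_lower hL, add_zero]
  constructor
  · rw [Finset.mul_sum, add_comm]
    simpa only [pow_succ'] using h
  · rw [Finset.sum_mul, add_comm]
    simpa only [pow_succ] using h
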